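/- arXiv:1910.11860 — 4 statements merged into one kernel-verified Lean document; each statement's English description precedes it below -/
import Mathlib

section
/- Let m ∈ (0,2]. There exists c ∈ (0,∞), depending only on m, such that for every δ ∈ (0,1) and all ξ, ξ' ∈ [0,∞) with |ξ − ξ'| < δ, one has ξ^{1−m/2} · |ξ^{m/2} − (ξ')^{m/2}| ≤ c δ. -/
/-- For `0 ≤ a ≤ 1`, the increments of `ξ ↦ ξ ^ a` are controlled by `|x - y|` once weighted
by `x ^ (1 - a)`. -/
theorem rpow_one_sub_mul_abs_rpow_sub_rpow_le {a x y : ℝ} (ha : 0 ≤ a) (ha' : a ≤ 1)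
    (hx : 0 ≤ x) (hy : 0 ≤ y) : x ^ (1 - a) * |x ^ a - y ^ a| ≤ |x - y| := by
  have split {z : ℝ} (hz : 0 ≤ z) : z ^ (1 - a) * z ^ a = z := by
    rw [← Real.rpow_add_of_nonneg hz (sub_nonneg.2 ha') ha, sub_add_cancel, Real.rpow_one]
  have hya : 0 ≤ y ^ a := Real.rpow_nonneg hy a
  rw [← abs_of_nonneg (Real.rpow_nonneg hx (1 - a)), ← abs_mul, mul_sub, split hx]
  rcases le_total y x with h | h
  · have h₁ : y ≤ x ^ (1 - a) * y ^ a := by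
      calc y = y ^ (1 - a) * y ^ a := (split hy).symm
        _ ≤ x ^ (1 - a) * y ^ a := by gcongr
    have h₂ : x ^ (1 - a) * y ^ a ≤ x := by
      calc x ^ (1 - a) * y ^ a ≤ x ^ (1 - a) * x ^ a := by gcongr
        _ = x := split hx
    rw [abs_of_nonneg (by linarith), abs_of_nonneg (by linarith)]
    linarith
  · have h₁ : x ^ (1 - a) * y ^ a ≤ y := by
      calc x ^ (1 - a) * y ^ a ≤ y ^ (1 - a) * y ^ a := by gcongr
        _ = y := split hy
    have h₂ : x ≤ x ^ (1 - a) * y ^ a := by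
      calc x = x ^ (1 - a) * x ^ a := (split hx).symm
        _ ≤ x ^ (1 - a) * y ^ a := by gcongr
    rw [abs_of_nonpos (by linarith), abs_of_nonpos (by linarith)]
    linarith

/-- The uniform (in the cutoff) estimate from Proposition A.1 for `Φ(ξ) = ξ^m`
with `m ∈ (0,2]`: there is `c > 0` such that, for every `δ ∈ (0,1)` and all
nonnegative `ξ, ξ'` with `|ξ - ξ'| < δ`,
`ξ^{1-m/2} |ξ^{m/2} - ξ'^{m/2}| ≤ c δ`. -/
theorem porousMedium_uniform_continuity_estimate
    (m : ℝ) (hm : m ∈ Set.Ioc (0:ℝ) 2) :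
    ∃ c : ℝ, 0 < c ∧ ∀ δ : ℝ, δ ∈ Set.Ioo (0:ℝ) 1 →
      ∀ ξ ξ' : ℝ, 0 ≤ ξ → 0 ≤ ξ' → |ξ - ξ'| < δ →
        ξ ^ (1 - m/2) * |ξ ^ (m/2) - ξ' ^ (m/2)| ≤ c * δ := by
  obtain ⟨hm₀, hm₂⟩ := hm
  refine ⟨1, one_pos, fun δ _ ξ ξ' hξ hξ' h => ?_⟩
  rw [one_mul]
  exact (rpow_one_sub_mul_abs_rpow_sub_rpow_le (by linarith) (by linarith) hξ hξ').trans h.le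
end

section
/- Let m ∈ (0,2]. There exists c ∈ (0,∞), depending only on m, such that for every δ ∈ (0,1) and all ξ, ξ' ∈ [0,∞) with |ξ − ξ'| < δ, one has ξ^{1−m/2} (ξ')^{1−m/2} (ξ^{(m−1)/2} − (ξ')^{(m−1)/2})² ≤ c δ. -/
/-- The square root is `1/2`-Hölder with constant one. -/
lemma sq_sub_rpow_half_le {x y : ℝ} (hx : 0 ≤ x) (hy : 0 ≤ y) :
    (x ^ (1/2 : ℝ) - y ^ (1/2 : ℝ)) ^ 2 ≤ |x - y| := by
  rw [← Real.sqrt_eq_rpow, ← Real.sqrt_eq_rpow]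
  have hsx := Real.sq_sqrt hx
  have hsy := Real.sq_sqrt hy
  have h0x := Real.sqrt_nonneg x
  have h0y := Real.sqrt_nonneg y
  rcases le_total y x with h | h
  · have := Real.sqrt_le_sqrt h
    rw [abs_of_nonneg (by linarith)]
    nlinarith
  · have := Real.sqrt_le_sqrt h
    rw [abs_of_nonpos (by linarith)]
    nlinarith

/-- By weighted AM-GM, the weighted squared increment is at most that of the square root. -/
lemma rpow_mul_rpow_mul_sq_sub_le {m x y : ℝ} (hm : m ∈ Set.Ioc (0:ℝ) 2)
    (hx : 0 < x) (hy : 0 < y) :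
    x ^ (1 - m/2) * y ^ (1 - m/2) * (x ^ ((m-1)/2) - y ^ ((m-1)/2)) ^ 2 ≤
      (x ^ (1/2 : ℝ) - y ^ (1/2 : ℝ)) ^ 2 := by
  have h₁ := Real.geom_mean_le_arith_mean2_weighted (w₁ := m/2) (w₂ := 1 - m/2)
    (by linarith [hm.1]) (by linarith [hm.2]) hx.le hy.le (by ring)
  have h₂ := Real.geom_mean_le_arith_mean2_weighted (w₁ := 1 - m/2) (w₂ := m/2)
    (by linarith [hm.2]) (by linarith [hm.1]) hx.le hy.le (by ring)
  have half {z : ℝ} (hz : 0 < z) : z ^ (1 - m/2) * z ^ ((m-1)/2) = z ^ (1/2 : ℝ) := by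
    rw [← Real.rpow_add hz]; ring_nf
  have half_mul {z : ℝ} (hz : 0 < z) : z ^ (1/2 : ℝ) * z ^ ((m-1)/2) = z ^ (m/2) := by
    rw [← Real.rpow_add hz]; ring_nf
  have half_sq {z : ℝ} (hz : 0 < z) : z ^ (1/2 : ℝ) * z ^ (1/2 : ℝ) = z := by
    rw [← Real.rpow_add hz]; norm_num
  calc x ^ (1 - m/2) * y ^ (1 - m/2) * (x ^ ((m-1)/2) - y ^ ((m-1)/2)) ^ 2
      = (x ^ (1 - m/2) * x ^ ((m-1)/2)) * x ^ ((m-1)/2) * y ^ (1 - m/2)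
        + x ^ (1 - m/2) * ((y ^ (1 - m/2) * y ^ ((m-1)/2)) * y ^ ((m-1)/2))
        - 2 * ((x ^ (1 - m/2) * x ^ ((m-1)/2)) * (y ^ (1 - m/2) * y ^ ((m-1)/2))) := by ring
    _ = x ^ (m/2) * y ^ (1 - m/2) + x ^ (1 - m/2) * y ^ (m/2)
        - 2 * (x ^ (1/2 : ℝ) * y ^ (1/2 : ℝ)) := by
      rw [half hx, half hy, half_mul hx, half_mul hy]
    _ ≤ x + y - 2 * (x ^ (1/2 : ℝ) * y ^ (1/2 : ℝ)) := by linarith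
    _ = (x ^ (1/2 : ℝ) - y ^ (1/2 : ℝ)) ^ 2 := by
      linear_combination -half_sq hx - half_sq hy

/-- The uniform (in the cutoff) estimate from Proposition A.1 for `Φ(ξ) = ξ^m`
with `m ∈ (0,2]`: there is `c > 0` such that for every `δ ∈ (0,1)` and all
nonnegative `ξ, ξ'` with `|ξ - ξ'| < δ`,
`ξ^{1-m/2} ξ'^{1-m/2} (ξ^{(m-1)/2} - ξ'^{(m-1)/2})² ≤ c δ`. -/
theorem porousMedium_uniform_continuity_estimate_sq
    (m : ℝ) (hm : m ∈ Set.Ioc (0:ℝ) 2) :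
    ∃ c : ℝ, 0 < c ∧ ∀ δ : ℝ, δ ∈ Set.Ioo (0:ℝ) 1 →
      ∀ ξ ξ' : ℝ, 0 ≤ ξ → 0 ≤ ξ' → |ξ - ξ'| < δ →
        ξ ^ (1 - m/2) * ξ' ^ (1 - m/2) *
          (ξ ^ ((m-1)/2) - ξ' ^ ((m-1)/2)) ^ 2 ≤ c * δ := by
  refine ⟨1, one_pos, fun δ _ ξ ξ' hξ hξ' h => ?_⟩
  suffices key : ξ ^ (1 - m/2) * ξ' ^ (1 - m/2) * (ξ ^ ((m-1)/2) - ξ' ^ ((m-1)/2)) ^ 2 ≤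
      |ξ - ξ'| by linarith
  rcases eq_or_ne m 2 with rfl | hm2
  · norm_num
    simpa using sq_sub_rpow_half_le hξ hξ'
  have hexp : 1 - m/2 ≠ 0 := fun h0 => hm2 (by linarith)
  rcases hξ.eq_or_lt with rfl | hpos
  · simp [Real.zero_rpow hexp]
  rcases hξ'.eq_or_lt with rfl | hpos'
  · simp [Real.zero_rpow hexp]
  exact (rpow_mul_rpow_mul_sq_sub_le hm hpos hpos').trans (sq_sub_rpow_half_le hξ hξ')
end

section
/- Let m ∈ [1,∞) and set Φ(ξ) = ξ^m on [0,∞), so that √(Φ'(ξ)) = √m · ξ^{(m−1)/2}, and define Θ(ξ) = ∫_0^ξ √(Φ'(t)) dt = (2√m/(m+1)) · ξ^{(m+1)/2}. Then there exists c ∈ (0,∞) such that: (a) √(Φ'(0)) ≤ c; (b) c · √(Φ'(ξ)) ≥ 1 for every ξ ≥ 1; and (c) for all ξ, ξ' ∈ [0,∞): if max(ξ, ξ') ≥ 1 then c · |Θ(ξ) − Θ(ξ')| ≥ |ξ − ξ'|, while if max(ξ, ξ') < 1 then c · |Θ(ξ) − Θ(ξ')| ≥ |ξ − ξ'|^{(m+1)/2}.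 In other words, Φ(ξ) = ξ^m satisfies the nondegeneracy Assumption 7.1 of the paper with exponent p = m. -/
theorem Real.sub_rpow_le_rpow_sub_rpow {p x y : ℝ} (hp : 1 ≤ p) (hy : 0 ≤ y) (hyx : y ≤ x) :
    (x - y) ^ p ≤ x ^ p - y ^ p := by
  have h := Real.add_rpow_le_rpow_add (sub_nonneg.2 hyx) hy hp
  rw [sub_add_cancel] at h
  linarith

theorem Real.sub_le_rpow_sub_rpow {p x y : ℝ} (hp : 1 ≤ p) (hy : 0 ≤ y) (hyx : y ≤ x)
    (hx : 1 ≤ x) : x - y ≤ x ^ p - y ^ p := by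
  have rpow_eq : ∀ z : ℝ, 0 ≤ z → z ^ p = z * z ^ (p - 1) := fun z hz ↦ by
    rw [← Real.rpow_one_add' hz (by linarith), add_sub_cancel]
  have h1 : 1 ≤ x ^ (p - 1) := Real.one_le_rpow hx (by linarith)
  have h2 : y ^ (p - 1) ≤ x ^ (p - 1) := Real.rpow_le_rpow hy hyx (by linarith)
  rw [rpow_eq x (hy.trans hyx), rpow_eq y hy]
  nlinarith [mul_le_mul_of_nonneg_left h2 hy, mul_le_mul_of_nonneg_left h1 (sub_nonneg.2 hyx)]

/-- Proposition A.5, nondegeneracy (Assumption 7.1) for `Φ(ξ) = ξ^m`, `m ≥ 1`,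
with `√(Φ'(ξ)) = √m ξ^{(m-1)/2}` and `Θ(ξ) = (2√m/(m+1)) ξ^{(m+1)/2}`:
there exists `c > 0` with `√(Φ'(0)) ≤ c`, `c √(Φ'(ξ)) ≥ 1` for `ξ ≥ 1`, and
`c |Θ(ξ) - Θ(ξ')| ≥ |ξ - ξ'|` when `max ξ ξ' ≥ 1`, while
`c |Θ(ξ) - Θ(ξ')| ≥ |ξ - ξ'|^{(m+1)/2}` when `max ξ ξ' < 1`. -/
theorem porousMedium_nondegeneracy (m : ℝ) (hm : 1 ≤ m) :
    ∃ c : ℝ, 0 < c ∧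
      (Real.sqrt m * (0:ℝ) ^ ((m - 1)/2) ≤ c) ∧
      (∀ ξ : ℝ, 1 ≤ ξ → 1 ≤ c * (Real.sqrt m * ξ ^ ((m - 1)/2))) ∧
      (∀ ξ ξ' : ℝ, 0 ≤ ξ → 0 ≤ ξ' →
        (1 ≤ max ξ ξ' →
          |ξ - ξ'| ≤ c * |(2 * Real.sqrt m / (m + 1)) * ξ ^ ((m + 1)/2) -
            (2 * Real.sqrt m / (m + 1)) * ξ' ^ ((m + 1)/2)|) ∧
        (max ξ ξ' < 1 →
          |ξ - ξ'| ^ ((m + 1)/2) ≤ c * |(2 * Real.sqrt m / (m + 1)) * ξ ^ ((m + 1)/2) -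
            (2 * Real.sqrt m / (m + 1)) * ξ' ^ ((m + 1)/2)|)) := by
  have hs : 1 ≤ √m := Real.one_le_sqrt.2 hm
  have hp : 1 ≤ (m + 1) / 2 := by linarith
  have key : ∀ a b : ℝ, |a - b| ≤ (m + 1) * |2 * √m / (m + 1) * a - 2 * √m / (m + 1) * b| := by
    intro a b
    rw [← mul_sub, abs_mul, abs_of_nonneg (a := 2 * √m / (m + 1)) (by positivity), ← mul_assoc,
      mul_div_cancel₀ _ (by positivity)]
    exact le_mul_of_one_le_left (abs_nonneg _) (by linarith)
  refine ⟨m + 1, by linarith, ?_, fun ξ hξ ↦ ?_, fun ξ ξ' hξ hξ' ↦ ?_⟩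
  · have h1 : √m * (0 : ℝ) ^ ((m - 1) / 2) ≤ √m :=
      mul_le_of_le_one_right (by positivity) (Real.zero_rpow_le_one _)
    nlinarith [Real.sq_sqrt (zero_le_one.trans hm)]
  · have h1 : 1 ≤ ξ ^ ((m - 1) / 2) := Real.one_le_rpow hξ (by linarith)
    exact one_le_mul_of_one_le_of_one_le (by linarith) (one_le_mul_of_one_le_of_one_le hs h1)
  · refine ⟨fun hmax ↦ le_trans ?_ (key _ _), fun _ ↦ le_trans ?_ (key _ _)⟩
    · rcases le_total ξ' ξ with h | h
      · rw [max_eq_left h] at hmax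
        rw [abs_of_nonneg (sub_nonneg.2 h)]
        exact (Real.sub_le_rpow_sub_rpow hp hξ' h hmax).trans (le_abs_self _)
      · rw [max_eq_right h] at hmax
        rw [abs_sub_comm, abs_of_nonneg (sub_nonneg.2 h), abs_sub_comm]
        exact (Real.sub_le_rpow_sub_rpow hp hξ h hmax).trans (le_abs_self _)
    · rcases le_total ξ' ξ with h | h
      · rw [abs_of_nonneg (sub_nonneg.2 h)]
        exact (Real.sub_rpow_le_rpow_sub_rpow hp hξ' h).trans (le_abs_self _)
      · rw [abs_sub_comm, abs_of_nonneg (sub_nonneg.2 h), abs_sub_comm]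
        exact (Real.sub_rpow_le_rpow_sub_rpow hp hξ h).trans (le_abs_self _)
end

section
/- Let h : [0,∞) → [0,∞) be continuous and nondecreasing with h(0) = 0. Then there exists a family (h_η)_{η∈(0,1)} of infinitely differentiable, nondecreasing functions h_η : [0,∞) → [0,∞) with the following properties: (i) h_η(0) = 0 for every η ∈ (0,1); (ii) 0 ≤ h_η(ξ) ≤ 2 h(ξ) for every η ∈ (0,1) and every ξ ∈ [0,∞); (iii) for every η ∈ (0,1), both h_η and its derivative h_η' are bounded on [0,∞); and (iv) for every compact subset A ⊆ [0,∞), sup_{ξ∈A} |h_η(ξ) − h(ξ)| → 0 as η → 0. -/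
open scoped Topology

open MeasureTheory Set
open scoped Convolution

/-- Smoothing of a function by convolution with a normalized bump supported in `[0, r]`. -/
noncomputable def oneSidedMollify {r : ℝ} (φ : ContDiffBump (r / 2)) (g : ℝ → ℝ) : ℝ → ℝ :=
  φ.normed volume ⋆[ContinuousLinearMap.lsmul ℝ ℝ, volume] g

section OneSidedMollify

variable {r : ℝ} {φ : ContDiffBump (r / 2)} {g : ℝ → ℝ}

lemma oneSidedMollify_apply (x : ℝ) :
    oneSidedMollify φ g x = ∫ t, φ.normed volume t * g (x - t) := rfl

lemma integrable_normed_mul_comp_sub (hg : Continuous g) (x : ℝ) :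
    Integrable fun t => φ.normed volume t * g (x - t) :=
  (φ.continuous_normed.mul (by fun_prop)).integrable_of_hasCompactSupport
    φ.hasCompactSupport_normed.mul_right

lemma contDiff_oneSidedMollify (hg : Continuous g) {n : ℕ∞} :
    ContDiff ℝ n (oneSidedMollify φ g) :=
  φ.hasCompactSupport_normed.contDiff_convolution_left _ φ.contDiff_normed hg.locallyIntegrable

lemma monotone_oneSidedMollify (hg : Continuous g) (hm : Monotone g) :
    Monotone (oneSidedMollify φ g) := fun x y hxy => by
  simp only [oneSidedMollify_apply]
  refine integral_mono (integrable_normed_mul_comp_sub hg x)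
    (integrable_normed_mul_comp_sub hg y) fun t => ?_
  exact mul_le_mul_of_nonneg_left (hm (by linarith)) (φ.nonneg_normed t)

lemma mem_Icc_of_normed_ne_zero (hφ : φ.rOut = r / 2) {t : ℝ} (ht : φ.normed volume t ≠ 0) :
    t ∈ Icc 0 r := by
  have hs : t ∈ Function.support (φ.normed volume) := ht
  rw [φ.support_normed_eq, hφ, Real.ball_eq_Ioo] at hs
  exact ⟨by linarith [hs.1], by linarith [hs.2]⟩

lemma oneSidedMollify_le (hφ : φ.rOut = r / 2) (hg : Continuous g) (hm : Monotone g) (x : ℝ) :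
    oneSidedMollify φ g x ≤ g x := by
  have hc : ∫ t, φ.normed volume t * g x = g x := by
    rw [integral_mul_const, φ.integral_normed, one_mul]
  rw [oneSidedMollify_apply, ← hc]
  refine integral_mono (integrable_normed_mul_comp_sub hg x)
    (φ.integrable_normed.mul_const _) fun t => ?_
  by_cases ht : φ.normed volume t = 0
  · simp [ht]
  · exact mul_le_mul_of_nonneg_left
      (hm (by linarith [(mem_Icc_of_normed_ne_zero hφ ht).1])) (φ.nonneg_normed t)

lemma le_oneSidedMollify (hφ : φ.rOut = r / 2) (hg : Continuous g) (hm : Monotone g) (x : ℝ) :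
    g (x - r) ≤ oneSidedMollify φ g x := by
  have hc : ∫ t, φ.normed volume t * g (x - r) = g (x - r) := by
    rw [integral_mul_const, φ.integral_normed, one_mul]
  rw [oneSidedMollify_apply, ← hc]
  refine integral_mono (φ.integrable_normed.mul_const _)
    (integrable_normed_mul_comp_sub hg x) fun t => ?_
  by_cases ht : φ.normed volume t = 0
  · simp [ht]
  · exact mul_le_mul_of_nonneg_left
      (hm (by linarith [(mem_Icc_of_normed_ne_zero hφ ht).2])) (φ.nonneg_normed t)

lemma abs_deriv_oneSidedMollify_le (hg : Continuous g) {M : ℝ} (hM : ∀ x, |g x| ≤ M) (x : ℝ) :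
    |deriv (oneSidedMollify φ g) x| ≤ (∫ t, |deriv (φ.normed volume) t|) * M := by
  have hφ1 : ContDiff ℝ 1 (φ.normed volume) := φ.contDiff_normed (n := 1)
  have hd := φ.hasCompactSupport_normed.hasDerivAt_convolution_left (μ := volume)
    (ContinuousLinearMap.lsmul ℝ ℝ) hφ1 hg.locallyIntegrable x
  have hint : Integrable fun t => |deriv (φ.normed volume) t| :=
    ((hφ1.continuous_deriv le_rfl).integrable_of_hasCompactSupport
      (φ.hasCompactSupport_normed (μ := volume)).deriv).abs
  rw [oneSidedMollify, hd.deriv, ← integral_mul_const, ← Real.norm_eq_abs]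
  refine norm_integral_le_of_norm_le (hint.mul_const M) (.of_forall fun t => ?_)
  simp only [ContinuousLinearMap.lsmul_apply, smul_eq_mul, norm_mul, Real.norm_eq_abs]
  exact mul_le_mul_of_nonneg_left (hM _) (abs_nonneg _)

end OneSidedMollify

/-- A bump whose support is the interval `(0, r)`. -/
noncomputable def halfBump (r : ℝ) (hr : 0 < r) : ContDiffBump (r / 2) :=
  ⟨r / 4, r / 2, by linarith, by linarith⟩

/-- Lemma 5.4 ("ass_phi_reg"): for a continuous, nondecreasing
`h : [0,∞) → [0,∞)` with `h(0) = 0` there is a family `(h_η)_{η ∈ (0,1)}` of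
smooth, nondecreasing functions on `[0,∞)` with `h_η(0) = 0`,
`0 ≤ h_η ≤ 2 h`, bounded `h_η` and bounded derivative, and
`sup_{ξ ∈ A} |h_η(ξ) - h(ξ)| → 0` as `η → 0⁺` for every compact `A ⊆ [0,∞)`. -/
theorem exists_smooth_bounded_approximation
    (h : ℝ → ℝ) (hcont : ContinuousOn h (Set.Ici 0))
    (hmono : MonotoneOn h (Set.Ici 0))
    (hnonneg : ∀ ξ : ℝ, 0 ≤ ξ → 0 ≤ h ξ) (h0 : h 0 = 0) :
    ∃ H : ℝ → ℝ → ℝ,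
      (∀ η, η ∈ Set.Ioo (0:ℝ) 1 →
        ContDiffOn ℝ (⊤ : ℕ∞) (H η) (Set.Ici 0) ∧
        MonotoneOn (H η) (Set.Ici 0) ∧
        H η 0 = 0 ∧
        (∀ ξ : ℝ, 0 ≤ ξ → 0 ≤ H η ξ ∧ H η ξ ≤ 2 * h ξ) ∧
        (∃ C : ℝ, ∀ ξ : ℝ, 0 ≤ ξ →
          |H η ξ| ≤ C ∧ |derivWithin (H η) (Set.Ici 0) ξ| ≤ C)) ∧
      (∀ A : Set ℝ, A ⊆ Set.Ici 0 → IsCompact A →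
        Filter.Tendsto (fun η => ⨆ ξ ∈ A, |H η ξ - h ξ|) (𝓝[>] (0:ℝ)) (𝓝 0)) := by
  set k : ℝ → ℝ := fun t => h (max t 0) with hk
  have hkc : Continuous k :=
    hcont.comp_continuous (by fun_prop) fun t => le_max_right t 0
  have hkm : Monotone k := fun x y hxy =>
    hmono (le_max_right x 0) (le_max_right y 0) (max_le_max_right 0 hxy)
  have hkh : ∀ ξ, 0 ≤ ξ → k ξ = h ξ := fun ξ hξ => by simp [hk, hξ]
  have hk0 : ∀ t, 0 ≤ k t := fun t => hnonneg _ (le_max_right t 0)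
  have hkneg : ∀ t, t ≤ 0 → k t = 0 := fun t ht => by simp [hk, ht, h0]
  set g : ℝ → ℝ → ℝ := fun η t => min (k t) η⁻¹ with hgdef
  have hgc : ∀ η, Continuous (g η) := fun η => hkc.min continuous_const
  have hgm : ∀ η, Monotone (g η) := fun η x y hxy => min_le_min_right _ (hkm hxy)
  have hg0 : ∀ η, 0 < η → ∀ t, 0 ≤ g η t := fun η hη t => le_min (hk0 t) (by positivity)
  let H : ℝ → ℝ → ℝ := fun η =>
    if hη : 0 < η then oneSidedMollify (halfBump η hη) (g η) else 0
  have hH : ∀ η (hη : 0 < η), H η = oneSidedMollify (halfBump η hη) (g η) :=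
    fun η hη => dif_pos hη
  have hub : ∀ η, 0 < η → ∀ x, H η x ≤ g η x := fun η hη x => by
    rw [hH η hη]; exact oneSidedMollify_le rfl (hgc η) (hgm η) x
  have hlb : ∀ η, 0 < η → ∀ x, g η (x - η) ≤ H η x := fun η hη x => by
    rw [hH η hη]; exact le_oneSidedMollify rfl (hgc η) (hgm η) x
  have hnn : ∀ η, 0 < η → ∀ x, 0 ≤ H η x := fun η hη x => (hg0 η hη _).trans (hlb η hη x)
  refine ⟨H, ?_, ?_⟩
  · rintro η ⟨hη, -⟩
    have hsm : ContDiff ℝ (⊤ : ℕ∞) (H η) := by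
      rw [hH η hη]; exact contDiff_oneSidedMollify (hgc η)
    refine ⟨hsm.contDiffOn, ?_, ?_, fun ξ hξ => ⟨hnn η hη ξ, ?_⟩, ?_⟩
    · rw [hH η hη]; exact (monotone_oneSidedMollify (hgc η) (hgm η)).monotoneOn _
    · refine le_antisymm ((hub η hη 0).trans ?_) (hnn η hη 0)
      exact (min_le_left _ _).trans (hkneg 0 le_rfl).le
    · have h1 : H η ξ ≤ h ξ := (hub η hη ξ).trans ((min_le_left _ _).trans (hkh ξ hξ).le)
      linarith [hnonneg ξ hξ]
    · have hgabs : ∀ t, |g η t| ≤ η⁻¹ := fun t => by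
        rw [abs_of_nonneg (hg0 η hη t)]; exact min_le_right _ _
      refine ⟨max η⁻¹ ((∫ t, |deriv ((halfBump η hη).normed volume) t|) * η⁻¹),
        fun ξ hξ => ⟨?_, ?_⟩⟩
      · rw [abs_of_nonneg (hnn η hη ξ)]
        exact ((hub η hη ξ).trans (min_le_right _ _)).trans (le_max_left _ _)
      · rw [((hsm.differentiable (by simp)) ξ).derivWithin (uniqueDiffOn_Ici 0 ξ hξ), hH η hη]
        exact (abs_deriv_oneSidedMollify_le (hgc η) hgabs ξ).trans (le_max_right _ _)
  · intro A hA hAc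
    obtain ⟨R, hR⟩ := hAc.bddAbove
    rw [Metric.tendsto_nhds]
    intro ε hε
    have huc : UniformContinuousOn k (Icc (-1) R) :=
      isCompact_Icc.uniformContinuousOn_of_continuous hkc.continuousOn
    obtain ⟨δ, hδ, hkδ⟩ := Metric.uniformContinuousOn_iff.1 huc (ε / 2) (by positivity)
    have hlarge : ∀ᶠ η : ℝ in 𝓝[>] 0, k R ≤ η⁻¹ :=
      tendsto_inv_nhdsGT_zero.eventually_ge_atTop (k R)
    have hsmall : ∀ᶠ η : ℝ in 𝓝[>] 0, η ∈ Ioo 0 (min δ 1) :=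
      Ioo_mem_nhdsGT (lt_min hδ one_pos)
    filter_upwards [hlarge, hsmall] with η hηR ⟨hη, hηδ⟩
    have hη1 : η < δ := hηδ.trans_le (min_le_left _ _)
    have hη2 : η < 1 := hηδ.trans_le (min_le_right _ _)
    have hbound : ∀ ξ ∈ A, |H η ξ - h ξ| ≤ ε / 2 := fun ξ hξ => by
      have hξ0 : 0 ≤ ξ := hA hξ
      have hξR : ξ ≤ R := hR hξ
      have hd := hkδ ξ ⟨by linarith, hξR⟩ (ξ - η) ⟨by linarith, by linarith⟩
        (by rw [Real.dist_eq, sub_sub_cancel, abs_of_pos hη]; exact hη1)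
      rw [Real.dist_eq, abs_lt] at hd
      have hl : k (ξ - η) ≤ H η ξ := by
        refine le_trans (le_min le_rfl ?_) (hlb η hη ξ)
        exact (hkm (by linarith)).trans hηR
      have hu : H η ξ ≤ k ξ := (hub η hη ξ).trans (min_le_left _ _)
      rw [← hkh ξ hξ0, abs_le]
      constructor <;> linarith [hd.2]
    have hle : (⨆ ξ ∈ A, |H η ξ - h ξ|) ≤ ε / 2 :=
      Real.iSup_le (fun ξ => Real.iSup_le (hbound ξ) (by positivity)) (by positivity)
    have hge : 0 ≤ ⨆ ξ ∈ A, |H η ξ - h ξ| :=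
      Real.iSup_nonneg fun ξ => Real.iSup_nonneg fun _ => abs_nonneg _
    rw [Real.dist_eq, sub_zero, abs_of_nonneg hge]
    linarith
end
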